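/- Let n ≥ 1. A smooth function ω : ℝ^n → ℝ satisfies the covariant Hessian equation on hyperbolic space, D_αD_β ω(y) = h_{αβ}(y) ω(y) for all y and all α, β (this is the equation (D_αD_β + ν₀ h_{αβ})ω = 0 with ν₀ = −1), if and only if there exists a unique vector T ∈ ℝ^{1,n} such that ω(y) = η(P̃(y), T) for all y ∈ ℝ^n. Consequently, the space of solutions is (n+1)-dimensional and the translation part of the symmetry algebra of the flat Carroll–AdS model of Ti is ℝ^{n,1}. -/

import Mathlib

open scoped BigOperators
open Filter MeasureTheory

noncomputable section

/-- Minkowski inner product on `ℝ^{1,n}` (mostly plus signature). -/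
def minkowski (n : ℕ) (X Y : Fin (n+1) → ℝ) : ℝ :=
  -(X 0 * Y 0) + ∑ i : Fin n, X i.succ * Y i.succ

/-- Parametrization of the future unit hyperboloid `H^n ⊂ ℝ^{1,n}`. -/
def hyp (n : ℕ) (y : Fin n → ℝ) : Fin (n+1) → ℝ :=
  Fin.cons (Real.sqrt (1 + ∑ i, y i ^ 2)) y

/-- Partial derivative in the `i`-th coordinate direction. -/
def pdv {m : ℕ} {F : Type*} [NormedAddCommGroup F] [NormedSpace ℝ F]
    (i : Fin m) (f : (Fin m → ℝ) → F) (x : Fin m → ℝ) : F :=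
  fderiv ℝ f x (Pi.single i 1)

/-- The hyperbolic metric in the chart: `h_{αβ}(y) = δ_{αβ} - y_α y_β/(1+|y|²)`. -/
def hmet (n : ℕ) (y : Fin n → ℝ) (α β : Fin n) : ℝ :=
  (if α = β then 1 else 0) - y α * y β / (1 + ∑ i, y i ^ 2)

/-- The inverse hyperbolic metric in the chart: `h^{αβ}(y) = δ^{αβ} + y^α y^β`. -/
def hinvmet (n : ℕ) (y : Fin n → ℝ) (α β : Fin n) : ℝ :=
  (if α = β then 1 else 0) + y α * y β

/-- Christoffel symbols of the hyperbolic metric. -/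
def Chr (n : ℕ) (y : Fin n → ℝ) (γ α β : Fin n) : ℝ :=
  (1/2) * ∑ δ, hinvmet n y γ δ *
    (pdv α (fun y => hmet n y δ β) y + pdv β (fun y => hmet n y δ α) y
      - pdv δ (fun y => hmet n y α β) y)

section PartialDerivative

variable {m : ℕ} {f g : (Fin m → ℝ) → ℝ} {x : Fin m → ℝ}

lemma pdv_const (i : Fin m) (c : ℝ) (x : Fin m → ℝ) : pdv i (fun _ => c) x = 0 := by
  simp [pdv]

lemma pdv_apply (i j : Fin m) (x : Fin m → ℝ) :
    pdv i (fun y => y j) x = if j = i then 1 else 0 := by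
  rw [pdv, (hasFDerivAt_apply j x).fderiv]
  simp [Pi.single_apply]

lemma pdv_add (i : Fin m) (hf : DifferentiableAt ℝ f x) (hg : DifferentiableAt ℝ g x) :
    pdv i (fun y => f y + g y) x = pdv i f x + pdv i g x := by
  simp [pdv, fderiv_fun_add hf hg]

lemma pdv_sub (i : Fin m) (hf : DifferentiableAt ℝ f x) (hg : DifferentiableAt ℝ g x) :
    pdv i (fun y => f y - g y) x = pdv i f x - pdv i g x := by
  simp [pdv, fderiv_fun_sub hf hg]

lemma pdv_mul (i : Fin m) (hf : DifferentiableAt ℝ f x) (hg : DifferentiableAt ℝ g x) :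
    pdv i (fun y => f y * g y) x = pdv i f x * g x + f x * pdv i g x := by
  simp [pdv, fderiv_fun_mul hf hg]
  ring

lemma differentiableAt_div (hf : DifferentiableAt ℝ f x) (hg : DifferentiableAt ℝ g x)
    (h0 : g x ≠ 0) : DifferentiableAt ℝ (fun y => f y / g y) x := by
  simp only [div_eq_mul_inv]
  exact hf.fun_mul (hg.fun_inv h0)

lemma pdv_div (i : Fin m) (hf : DifferentiableAt ℝ f x) (hg : DifferentiableAt ℝ g x)
    (h0 : g x ≠ 0) :
    pdv i (fun y => f y / g y) x = (pdv i f x * g x - f x * pdv i g x) / g x ^ 2 := by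
  have h : HasFDerivAt (fun y => (g y)⁻¹) _ x :=
    (hasDerivAt_inv h0).comp_hasFDerivAt x hg.hasFDerivAt
  have hinv : pdv i (fun y => (g y)⁻¹) x = -(g x ^ 2)⁻¹ * pdv i g x := by
    rw [pdv, h.fderiv]
    simp [pdv]
  simp only [div_eq_mul_inv]
  rw [pdv_mul i hf (hg.fun_inv h0), hinv]
  field_simp
  ring

lemma pdv_sqrt (i : Fin m) (hf : DifferentiableAt ℝ f x) (h0 : f x ≠ 0) :
    pdv i (fun y => √(f y)) x = pdv i f x / (2 * √(f x)) := by
  rw [pdv, (hf.hasFDerivAt.sqrt h0).fderiv]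
  simp [pdv]
  ring

lemma pdv_sum {ι : Type*} (s : Finset ι) {F : ι → (Fin m → ℝ) → ℝ} (i : Fin m)
    (hF : ∀ j ∈ s, DifferentiableAt ℝ (F j) x) :
    pdv i (fun y => ∑ j ∈ s, F j y) x = ∑ j ∈ s, pdv i (F j) x := by
  simp [pdv, fderiv_fun_sum hF]

lemma eq_of_pdv_eq_zero (hf : Differentiable ℝ f) (h : ∀ x i, pdv i f x = 0)
    (x y : Fin m → ℝ) : f x = f y := by
  refine is_const_of_fderiv_eq_zero hf (fun z => ?_) x y
  refine ContinuousLinearMap.coe_injective (LinearMap.pi_ext' fun i => LinearMap.ext_ring ?_)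
  simpa [pdv] using h z i

lemma ContDiff.pdv (hf : ContDiff ℝ (⊤ : ℕ∞) f) (i : Fin m) :
    ContDiff ℝ (⊤ : ℕ∞) (pdv i f) :=
  (hf.fderiv_right (m := (⊤ : ℕ∞)) (by simp)).clm_apply contDiff_const

end PartialDerivative

section Hyperboloid

variable {n : ℕ}

lemma one_add_sum_sq_pos (y : Fin n → ℝ) : 0 < 1 + ∑ i, y i ^ 2 := by positivity

lemma pdv_one_add_sum_sq (α : Fin n) (y : Fin n → ℝ) :
    pdv α (fun y : Fin n → ℝ => 1 + ∑ i, y i ^ 2) y = 2 * y α := by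
  rw [pdv_add α (by fun_prop) (by fun_prop), pdv_const, pdv_sum _ α (fun _ _ => by fun_prop)]
  simp only [pow_two]
  simp_rw [pdv_mul α (differentiableAt_apply _ y) (differentiableAt_apply _ y), pdv_apply]
  simp [Finset.sum_add_distrib]
  ring

lemma pdv_sqrt_one_add_sum_sq (α : Fin n) (y : Fin n → ℝ) :
    pdv α (fun y : Fin n → ℝ => √(1 + ∑ i, y i ^ 2)) y = y α / √(1 + ∑ i, y i ^ 2) := by
  rw [pdv_sqrt α (by fun_prop) (one_add_sum_sq_pos y).ne', pdv_one_add_sum_sq]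
  exact mul_div_mul_left _ _ two_ne_zero

lemma differentiable_sqrt_one_add_sum_sq :
    Differentiable ℝ (fun y : Fin n → ℝ => √(1 + ∑ i, y i ^ 2)) := fun y =>
  DifferentiableAt.sqrt (by fun_prop) (one_add_sum_sq_pos y).ne'

lemma pdv_hmet (γ α β : Fin n) (y : Fin n → ℝ) :
    pdv γ (fun y => hmet n y α β) y =
      -((if α = γ then 1 else 0) * y β + y α * (if β = γ then 1 else 0)) / (1 + ∑ i, y i ^ 2)
        + 2 * y α * y β * y γ / (1 + ∑ i, y i ^ 2) ^ 2 := by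
  have hq := (one_add_sum_sq_pos y).ne'
  unfold hmet
  rw [pdv_sub γ (by fun_prop) (differentiableAt_div (by fun_prop) (by fun_prop) hq),
    pdv_const, pdv_div γ (by fun_prop) (by fun_prop) hq,
    pdv_mul γ (by fun_prop) (by fun_prop), pdv_apply, pdv_apply, pdv_one_add_sum_sq]
  field_simp
  ring

lemma sum_hinvmet_mul (γ : Fin n) (y : Fin n → ℝ) :
    ∑ δ, hinvmet n y γ δ * y δ = (1 + ∑ i, y i ^ 2) * y γ := by
  simp only [hinvmet, add_mul, Finset.sum_add_distrib, ite_mul, one_mul, zero_mul,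
    Finset.sum_ite_eq, Finset.mem_univ, if_true, Finset.sum_mul]
  congr 1
  exact Finset.sum_congr rfl fun _ _ => by ring

lemma sum_hmet_mul (α : Fin n) (y : Fin n → ℝ) :
    ∑ γ, y γ * hmet n y α γ = y α / (1 + ∑ i, y i ^ 2) := by
  have hq := (one_add_sum_sq_pos y).ne'
  have h : ∀ γ, y γ * hmet n y α γ =
      (if α = γ then y γ else 0) - y γ ^ 2 * (y α / (1 + ∑ i, y i ^ 2)) := fun γ => by
    unfold hmet
    split_ifs <;> ring
  simp_rw [h, Finset.sum_sub_distrib, ← Finset.sum_mul]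
  simp only [Finset.sum_ite_eq, Finset.mem_univ, if_true]
  field_simp
  ring

lemma Chr_eq (γ α β : Fin n) (y : Fin n → ℝ) : Chr n y γ α β = -(y γ * hmet n y α β) := by
  have hq := (one_add_sum_sq_pos y).ne'
  have h : ∀ δ, pdv α (fun y => hmet n y δ β) y + pdv β (fun y => hmet n y δ α) y
      - pdv δ (fun y => hmet n y α β) y =
        y δ * (-2 * hmet n y α β / (1 + ∑ i, y i ^ 2)) := fun δ => by
    rw [pdv_hmet, pdv_hmet, pdv_hmet, hmet]
    simp only [eq_comm (b := δ), eq_comm (a := β) (b := α)]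
    field_simp
    ring
  simp_rw [Chr, h, ← mul_assoc, ← Finset.sum_mul, sum_hinvmet_mul]
  field_simp

lemma hessian_eq_iff (ω : (Fin n → ℝ) → ℝ) (y : Fin n → ℝ) (α β : Fin n) :
    pdv α (pdv β ω) y - ∑ γ, Chr n y γ α β * pdv γ ω y = hmet n y α β * ω y ↔
      pdv α (pdv β ω) y = hmet n y α β * (ω y - ∑ γ, y γ * pdv γ ω y) := by
  have h : ∑ γ, Chr n y γ α β * pdv γ ω y = -(hmet n y α β * ∑ γ, y γ * pdv γ ω y) := by
    rw [Finset.mul_sum, ← Finset.sum_neg_distrib]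
    exact Finset.sum_congr rfl fun γ _ => by rw [Chr_eq]; ring
  rw [h, mul_sub]
  constructor <;> intro h <;> linarith

lemma minkowski_hyp (y : Fin n → ℝ) (T : Fin (n + 1) → ℝ) :
    minkowski n (hyp n y) T = -(√(1 + ∑ i, y i ^ 2) * T 0) + ∑ i, y i * T i.succ := by
  simp [minkowski, hyp]

lemma minkowski_hyp_injective {T T' : Fin (n + 1) → ℝ}
    (h : ∀ y, minkowski n (hyp n y) T = minkowski n (hyp n y) T') : T = T' := by
  simp only [minkowski_hyp] at h
  have h0 : T 0 = T' 0 := by simpa using h 0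
  funext j
  refine Fin.cases h0 (fun i => ?_) j
  simpa [h0, Pi.single_apply] using h (Pi.single i 1)

lemma pdv_minkowski_hyp (T : Fin (n + 1) → ℝ) (β : Fin n) (y : Fin n → ℝ) :
    pdv β (fun y => minkowski n (hyp n y) T) y =
      y β / √(1 + ∑ i, y i ^ 2) * (-T 0) + T β.succ := by
  have hs := differentiable_sqrt_one_add_sum_sq y
  simp only [minkowski_hyp, ← mul_neg]
  rw [pdv_add β (by fun_prop) (by fun_prop), pdv_mul β hs (by fun_prop),
    pdv_sqrt_one_add_sum_sq, pdv_const, pdv_sum _ β (fun _ _ => by fun_prop)]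
  simp_rw [pdv_mul β (differentiableAt_apply _ y) (differentiableAt_const _), pdv_apply, pdv_const]
  simp

lemma pdv_pdv_minkowski_hyp (T : Fin (n + 1) → ℝ) (α β : Fin n) (y : Fin n → ℝ) :
    pdv α (pdv β (fun y => minkowski n (hyp n y) T)) y =
      hmet n y α β * (-T 0 / √(1 + ∑ i, y i ^ 2)) := by
  have hq := one_add_sum_sq_pos y
  have hs := differentiable_sqrt_one_add_sum_sq y
  have hs0 := (Real.sqrt_pos.2 hq).ne'
  have hd : DifferentiableAt ℝ (fun y : Fin n → ℝ => y β / √(1 + ∑ i, y i ^ 2)) y :=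
    differentiableAt_div (by fun_prop) hs hs0
  rw [funext (pdv_minkowski_hyp T β), pdv_add α (by fun_prop) (by fun_prop),
    pdv_mul α hd (by fun_prop), pdv_div α (by fun_prop) hs hs0, pdv_sqrt_one_add_sum_sq,
    pdv_apply, pdv_const, pdv_const, hmet, Real.sq_sqrt hq.le]
  simp only [eq_comm (a := β) (b := α)]
  field_simp
  rw [Real.sq_sqrt hq.le]
  field_simp
  ring

lemma minkowski_hyp_sub_radial (T : Fin (n + 1) → ℝ) (y : Fin n → ℝ) :
    minkowski n (hyp n y) T - ∑ γ, y γ * pdv γ (fun y => minkowski n (hyp n y) T) y =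
      -T 0 / √(1 + ∑ i, y i ^ 2) := by
  have hq := one_add_sum_sq_pos y
  have hs0 := (Real.sqrt_pos.2 hq).ne'
  have h : ∀ γ, y γ * (y γ / √(1 + ∑ i, y i ^ 2) * (-T 0) + T γ.succ) =
      y γ ^ 2 * (-T 0 / √(1 + ∑ i, y i ^ 2)) + y γ * T γ.succ := fun γ => by ring
  simp_rw [pdv_minkowski_hyp, minkowski_hyp, h, Finset.sum_add_distrib, ← Finset.sum_mul]
  field_simp
  linear_combination -T 0 * Real.mul_self_sqrt hq.le

lemma exists_eq_minkowski_hyp {ω : (Fin n → ℝ) → ℝ} (hω : ContDiff ℝ (⊤ : ℕ∞) ω)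
    (h : ∀ y α β, pdv α (pdv β ω) y = hmet n y α β * (ω y - ∑ γ, y γ * pdv γ ω y)) :
    ∃ T : Fin (n + 1) → ℝ, ∀ y, ω y = minkowski n (hyp n y) T := by
  have hω1 : Differentiable ℝ ω := hω.differentiable (by simp)
  have hω2 : ∀ β, Differentiable ℝ (pdv β ω) := fun β => (hω.pdv β).differentiable (by simp)
  set u : (Fin n → ℝ) → ℝ := fun y => ω y - ∑ γ, y γ * pdv γ ω y with hu
  have hud : Differentiable ℝ u := by fun_prop
  have hpu : ∀ y α, pdv α u y = -(u y * (y α / (1 + ∑ i, y i ^ 2))) := fun y α => by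
    rw [hu, pdv_sub α (by fun_prop) (by fun_prop), pdv_sum _ α (fun _ _ => by fun_prop)]
    simp_rw [pdv_mul α (differentiableAt_apply _ y) (hω2 _ y), pdv_apply, h]
    change _ = -(u y * _)
    rw [← sum_hmet_mul, Finset.sum_add_distrib, Finset.mul_sum]
    simp only [ite_mul, one_mul, zero_mul, Finset.sum_ite_eq', Finset.mem_univ, if_true,
      sub_add_cancel_left]
    congr 1
    exact Finset.sum_congr rfl fun γ _ => by ring
  have hc := eq_of_pdv_eq_zero (f := fun y => u y * √(1 + ∑ i, y i ^ 2))
    (hud.mul differentiable_sqrt_one_add_sum_sq) (fun y α => by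
      have hq := one_add_sum_sq_pos y
      have hs0 := (Real.sqrt_pos.2 hq).ne'
      rw [pdv_mul α (hud y) (differentiable_sqrt_one_add_sum_sq y), hpu, pdv_sqrt_one_add_sum_sq]
      field_simp
      rw [Real.sq_sqrt hq.le]
      ring)
  have hb : ∀ β y z, _ := fun β => eq_of_pdv_eq_zero (f := fun y => pdv β ω y - u y * y β)
    (by fun_prop) (fun y α => by
      rw [pdv_sub α (by fun_prop) (by fun_prop), pdv_mul α (hud y) (by fun_prop), h, hpu,
        pdv_apply, hmet]
      change _ * u y - _ = 0
      simp only [eq_comm (a := β) (b := α)]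
      ring)
  refine ⟨Fin.cons (-u 0) fun β => pdv β ω 0, fun y => ?_⟩
  have hcy : u y * √(1 + ∑ i, y i ^ 2) = u 0 := by simpa using hc y 0
  have hby : ∀ β, pdv β ω 0 = pdv β ω y - u y * y β := fun β => by simpa using hb β 0 y
  have hq := one_add_sum_sq_pos y
  have hsum : ∑ i, y i * (pdv i ω y - u y * y i) =
      ∑ i, y i * pdv i ω y - u y * ∑ i, y i ^ 2 := by
    rw [Finset.mul_sum, ← Finset.sum_sub_distrib]
    exact Finset.sum_congr rfl fun _ _ => by ring
  have huy : u y = ω y - ∑ γ, y γ * pdv γ ω y := rfl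
  simp only [minkowski_hyp, Fin.cons_zero, Fin.cons_succ, hby, hsum, ← hcy]
  linear_combination -u y * Real.mul_self_sqrt hq.le + huy

end Hyperboloid

/-- A smooth function `ω` on hyperbolic space satisfies `D_αD_βω = h_{αβ}ω`
(the equation `(D_αD_β + ν₀h_{αβ})ω = 0` with `ν₀ = -1`) if and only if
`ω(y) = η(P̃(y),T)` for a unique vector `T ∈ ℝ^{1,n}`. -/
theorem hessian_equation_solutions_are_translations
    (n : ℕ) (hn : 1 ≤ n) (ω : (Fin n → ℝ) → ℝ) (hω : ContDiff ℝ (⊤ : ℕ∞) ω) :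
    (∀ (y : Fin n → ℝ) (α β : Fin n),
        pdv α (pdv β ω) y - ∑ γ, Chr n y γ α β * pdv γ ω y = hmet n y α β * ω y)
      ↔ (∃! T : Fin (n+1) → ℝ, ∀ y, ω y = minkowski n (hyp n y) T) := by
  simp_rw [hessian_eq_iff]
  constructor
  · intro h
    obtain ⟨T, hT⟩ := exists_eq_minkowski_hyp hω h
    exact ⟨T, hT, fun T' hT' => minkowski_hyp_injective fun y => (hT' y).symm.trans (hT y)⟩
  · rintro ⟨T, hT, -⟩ y α β
    obtain rfl : ω = fun y => minkowski n (hyp n y) T := funext hT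
    rw [pdv_pdv_minkowski_hyp, minkowski_hyp_sub_radial]
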